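/- For every conformal transformation τ of 𝕊², one has I_{2/3}(ψ_τ) = 0; that is, each function ψ_τ = (3/4)ln 𝒥_τ + c_τ is an extremal of the Chang–Gui functional at the critical parameter α = 2/3. -/

import Mathlib

open MeasureTheory
open scoped Classical

noncomputable section

/-- Squared Euclidean norm on `ℝ²`. -/
def sq2 (x : ℝ × ℝ) : ℝ := x.1 ^ 2 + x.2 ^ 2

/-- Euclidean dot product on `ℝ³`. -/
def dot3 (a b : Fin 3 → ℝ) : ℝ := a 0 * b 0 + a 1 * b 1 + a 2 * b 2

/-- Squared Euclidean norm on `ℝ³`. -/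
def norm3sq (a : Fin 3 → ℝ) : ℝ := dot3 a a

/-- Stereographic projection from the north pole. -/
def SP (ω : Fin 3 → ℝ) : ℝ × ℝ := (ω 0 / (1 - ω 2), ω 1 / (1 - ω 2))

/-- Inverse stereographic projection. -/
def SPinv (x : ℝ × ℝ) : Fin 3 → ℝ :=
  ![2 * x.1 / (1 + sq2 x), 2 * x.2 / (1 + sq2 x), (sq2 x - 1) / (1 + sq2 x)]

/-- Identification `ℝ² ≅ ℂ`. -/
def cx (x : ℝ × ℝ) : ℂ := ⟨x.1, x.2⟩

/-- Identification `ℂ ≅ ℝ²`. -/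
def uncx (z : ℂ) : ℝ × ℝ := (z.re, z.im)

/-- The group `SL(2,ℂ)`. -/
abbrev SL2C := Matrix.SpecialLinearGroup (Fin 2) ℂ

/-- The Möbius transformation associated to `A ∈ SL(2,ℂ)`. -/
def TA (A : SL2C) (z : ℂ) : ℂ := (A.1 0 0 * z + A.1 0 1) / (A.1 1 0 * z + A.1 1 1)

/-- The north pole of `𝕊²`. -/
def northPole : Fin 3 → ℝ := ![0, 0, 1]

/-- The conformal transformation of `𝕊²` induced by `A ∈ SL(2,ℂ)` via stereographic
projection, extended continuously over the poles. -/
def tauA (A : SL2C) (ω : Fin 3 → ℝ) : Fin 3 → ℝ :=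
  if ω 2 = 1 then
    if A.1 1 0 = 0 then northPole else SPinv (uncx (A.1 0 0 / A.1 1 0))
  else if A.1 1 0 * cx (SP ω) + A.1 1 1 = 0 then northPole
  else SPinv (uncx (TA A (cx (SP ω))))

/-- The Jacobian `𝒥_{τ_A}(ω) = ((1+|z|²)/(|az+b|²+|cz+d|²))²`, `z = 𝒮(ω)`,
extended continuously over the north pole. -/
def jacA (A : SL2C) (ω : Fin 3 → ℝ) : ℝ :=
  if ω 2 = 1 then (1 / (Complex.normSq (A.1 0 0) + Complex.normSq (A.1 1 0))) ^ 2
  else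
    ((1 + Complex.normSq (cx (SP ω))) /
        (Complex.normSq (A.1 0 0 * cx (SP ω) + A.1 0 1) +
          Complex.normSq (A.1 1 0 * cx (SP ω) + A.1 1 1))) ^ 2

/-- `∫_{𝕊²} f dω = (1/π) ∫_{ℝ²} f(𝒮⁻¹(x)) (1+|x|²)⁻² dx`, the integral against the
normalized surface measure of `𝕊²`, written in stereographic coordinates. -/
def sphInt {E : Type*} [NormedAddCommGroup E] [NormedSpace ℝ E]
    (f : (Fin 3 → ℝ) → E) : E :=
  (1 / Real.pi) • ∫ x : ℝ × ℝ, ((1 + sq2 x)⁻¹) ^ 2 • f (SPinv x)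

/-- Integrability of `f : 𝕊² → ℝ` with respect to the normalized surface measure,
expressed in stereographic coordinates. -/
def SphIntegrable (f : (Fin 3 → ℝ) → ℝ) : Prop :=
  Integrable fun x : ℝ × ℝ => ((1 + sq2 x)⁻¹) ^ 2 * f (SPinv x)

/-- The mass `M_τ = ∫_{𝕊²} 𝒥_τ^{3/2} dω`. -/
def massA (A : SL2C) : ℝ := sphInt fun ω => jacA A ω ^ (3 / 2 : ℝ)

/-- The center of mass `a_τ = M_τ⁻¹ ∫_{𝕊²} ω 𝒥_τ^{3/2}(ω) dω`. -/
def comA (A : SL2C) : Fin 3 → ℝ :=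
  (massA A)⁻¹ • sphInt fun ω => jacA A ω ^ (3 / 2 : ℝ) • ω

/-- The normalizing constant `c_τ = -(1/2) ln M_τ`. -/
def cA (A : SL2C) : ℝ := -(1 / 2) * Real.log (massA A)

/-- `ψ_τ = (3/4) ln 𝒥_τ + c_τ`. -/
def psiA (A : SL2C) (ω : Fin 3 → ℝ) : ℝ := (3 / 4) * Real.log (jacA A ω) + cA A

/-- `|∇v(x)|²` for `v : ℝ² → ℝ`. -/
def gradSq (v : ℝ × ℝ → ℝ) (x : ℝ × ℝ) : ℝ :=
  fderiv ℝ v x (1, 0) ^ 2 + fderiv ℝ v x (0, 1) ^ 2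

/-- The Dirichlet energy `∫_{𝕊²} |∇_{𝕊²} u|² dω = (1/(4π)) ∫_{ℝ²} |∇(u∘𝒮⁻¹)(x)|² dx`. -/
def gradTerm (u : (Fin 3 → ℝ) → ℝ) : ℝ :=
  (1 / (4 * Real.pi)) * ∫ x : ℝ × ℝ, gradSq (fun y => u (SPinv y)) x

/-- Membership in the Sobolev space `H¹(𝕊²)`. -/
def MemH1 (u : (Fin 3 → ℝ) → ℝ) : Prop :=
  SphIntegrable u ∧ SphIntegrable (fun ω => u ω ^ 2) ∧
    Integrable fun x : ℝ × ℝ => gradSq (fun y => u (SPinv y)) x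

/-- The Chang–Gui functional `I_α`. -/
def CG (α : ℝ) (u : (Fin 3 → ℝ) → ℝ) : ℝ :=
  α * gradTerm u + 2 * sphInt u -
    (1 / 2) * Real.log
      ((sphInt fun ω => Real.exp (2 * u ω)) ^ 2 -
        norm3sq (sphInt fun ω => Real.exp (2 * u ω) • ω))

end


lemma sq2_nonneg (x : ℝ × ℝ) : 0 ≤ sq2 x := by unfold sq2; positivity

lemma sq2_cont : Continuous sq2 := by unfold sq2; fun_prop

lemma mu1_cont : Continuous (fun x : ℝ × ℝ => (1 + sq2 x)⁻¹) := by
  have := sq2_cont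
  refine Continuous.inv₀ (by fun_prop) (fun x => ?_)
  have := sq2_nonneg x
  positivity

lemma mu_cont : Continuous (fun x : ℝ × ℝ => ((1 + sq2 x)⁻¹) ^ 2) := mu1_cont.pow 2

lemma cont1 : Continuous (fun r : ℝ => (1 + r ^ 2)⁻¹) :=
  Continuous.inv₀ (by fun_prop) (fun x => by positivity)

lemma mu_int : Integrable (fun x : ℝ × ℝ => ((1 + sq2 x)⁻¹) ^ 2) := by
  have h := integrable_rpow_neg_one_add_norm_sq (E := ℝ × ℝ) (μ := volume) (r := 4)
    (by simp; norm_num)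
  refine h.mono' ?_ ?_
  · apply Continuous.aestronglyMeasurable
    have := sq2_cont
    exact mu_cont
  · filter_upwards with x
    have h1 := sq2_nonneg x
    have h2 : ‖x‖ ^ 2 ≤ sq2 x := by
      unfold sq2
      rw [Prod.norm_def]
      rcases max_choice ‖x.1‖ ‖x.2‖ with h | h <;> rw [h, Real.norm_eq_abs, sq_abs]
      · nlinarith [sq_nonneg x.2]
      · nlinarith [sq_nonneg x.1]
    rw [Real.norm_of_nonneg (by positivity)]
    have h3 : (1 + ‖x‖ ^ 2) ^ (-(4:ℝ) / 2) = ((1 + ‖x‖ ^ 2)⁻¹) ^ 2 := by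
      rw [show (-(4:ℝ) / 2) = -((2:ℕ):ℝ) by norm_num, Real.rpow_neg (by positivity),
        Real.rpow_natCast, inv_pow]
    rw [h3]
    gcongr

lemma bdd_int {f : ℝ × ℝ → ℝ} (hf : Continuous f) (C : ℝ) (hC : ∀ x, |f x| ≤ C) :
    Integrable (fun x : ℝ × ℝ => ((1 + sq2 x)⁻¹) ^ 2 * f x) := by
  have := mu_int.bdd_mul (f := f) (c := C) hf.aestronglyMeasurable
    (Filter.Eventually.of_forall hC)
  simpa [mul_comm] using this

lemma radial (f : ℝ → ℝ) :
    ∫ x : ℝ × ℝ, f (sq2 x) = 2 * Real.pi * ∫ r in Set.Ioi (0:ℝ), r * f (r ^ 2) := by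
  rw [← integral_comp_polarCoord_symm, polarCoord_target]
  have h := setIntegral_prod_mul (μ := (volume : Measure ℝ)) (ν := (volume : Measure ℝ))
    (fun r : ℝ => r * f (r ^ 2)) (fun _ : ℝ => (1:ℝ)) (Set.Ioi 0) (Set.Ioo (-Real.pi) Real.pi)
  have e : ∀ p : ℝ × ℝ, sq2 (polarCoord.symm p) = p.1 ^ 2 := by
    intro p
    simp only [sq2, polarCoord_symm_apply]
    linear_combination p.1 ^ 2 * Real.sin_sq_add_cos_sq p.2
  simp only [e, smul_eq_mul]
  simp only [mul_one] at h
  rw [Measure.volume_eq_prod, h]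
  simp [Real.pi_pos.le]
  ring

lemma aux_int1 (f : ℝ → ℝ) (hf : ContinuousOn f (Set.Ioi 0)) (C : ℝ)
    (hC : ∀ x ∈ Set.Ioi (0:ℝ), |f x| ≤ C) :
    IntegrableOn (fun r : ℝ => r * (((1 + r ^ 2)⁻¹) ^ 2 * f r)) (Set.Ioi 0) := by
  have h := (integrable_inv_one_add_sq.const_mul C).integrableOn (s := Set.Ioi (0:ℝ))
  refine h.mono' ?_ ?_
  · apply ContinuousOn.aestronglyMeasurable _ measurableSet_Ioi
    apply continuousOn_id.mul
    apply ContinuousOn.mul _ hf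
    apply Continuous.continuousOn
    exact cont1.pow 2
  · refine (ae_restrict_iff' measurableSet_Ioi).2 (Filter.Eventually.of_forall ?_)
    intro r hr
    have hr' : 0 < r := hr
    have := hC r hr
    have h0 : 0 ≤ |f r| := abs_nonneg _
    rw [Real.norm_eq_abs, abs_mul, abs_mul, abs_of_pos hr', abs_of_pos (by positivity)]
    have : r * (1 + r ^ 2)⁻¹ ≤ 1 := by
      rw [← div_eq_mul_inv, div_le_one (by positivity)]
      nlinarith [sq_nonneg (r - 1)]
    calc r * ((1 + r ^ 2)⁻¹ ^ 2 * |f r|) = (r * (1 + r ^ 2)⁻¹) * (|f r| * (1 + r ^ 2)⁻¹) := by ring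
      _ ≤ 1 * (C * (1 + r ^ 2)⁻¹) := by gcongr
      _ = _ := one_mul _

lemma tend_inv : Filter.Tendsto (fun r : ℝ => (1 + r ^ 2)⁻¹) Filter.atTop (nhds 0) := by
  apply Filter.Tendsto.inv_tendsto_atTop
  exact Filter.tendsto_atTop_add_const_left _ _ (Filter.tendsto_pow_atTop (by norm_num))

lemma hd_inv (r : ℝ) : HasDerivAt (fun r : ℝ => (1 + r ^ 2)⁻¹)
    (-(2 * r) * ((1 + r ^ 2)⁻¹) ^ 2) r := by
  have h : HasDerivAt (fun r : ℝ => 1 + r ^ 2) (2 * r) r := by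
    simpa using (hasDerivAt_pow 2 r).const_add 1
  have := h.inv (by positivity)
  refine this.congr_deriv ?_
  rw [inv_pow, div_eq_mul_inv]

lemma mu_val : ∫ x : ℝ × ℝ, ((1 + sq2 x)⁻¹) ^ 2 = Real.pi := by
  rw [radial (fun t => ((1 + t)⁻¹) ^ 2)]
  have h := integral_Ioi_of_hasDerivAt_of_tendsto' (a := (0:ℝ)) (m := (0:ℝ))
    (f := fun r : ℝ => -(1/2) * (1 + r ^ 2)⁻¹) (f' := fun r : ℝ => r * ((1 + r ^ 2)⁻¹) ^ 2)
    (fun r _ => ((hd_inv r).const_mul (-(1/2))).congr_deriv (by ring))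
    (by simpa using aux_int1 (fun _ => 1) continuousOn_const 1 (by simp))
    (by simpa using tend_inv.const_mul (-(1/2) : ℝ))
  rw [h]; norm_num; ring

lemma mu3_val : ∫ x : ℝ × ℝ, ((1 + sq2 x)⁻¹) ^ 3 = Real.pi / 2 := by
  rw [radial (fun t => ((1 + t)⁻¹) ^ 3)]
  have h := integral_Ioi_of_hasDerivAt_of_tendsto' (a := (0:ℝ)) (m := (0:ℝ))
    (f := fun r : ℝ => -(1/4) * ((1 + r ^ 2)⁻¹) ^ 2) (f' := fun r : ℝ => r * ((1 + r ^ 2)⁻¹) ^ 3)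
    (fun r _ => (((hd_inv r).pow 2).const_mul (-(1/4))).congr_deriv (by push_cast; ring))
    (by
      have := aux_int1 (fun r => (1 + r ^ 2)⁻¹) (Continuous.continuousOn
        cont1) 1 (by
        intro x _
        rw [abs_of_pos (by positivity)]
        exact inv_le_one_of_one_le₀ (by nlinarith [sq_nonneg x]))
      refine this.congr_fun (fun r _ => ?_) measurableSet_Ioi
      simp only []; ring)
    (by simpa using (tend_inv.pow 2).const_mul (-(1/4) : ℝ))
  rw [h]; norm_num; ring

lemma int_Phi (l m : ℝ) (hl : 0 < l) (hm : 0 < m) (hlm : l * m = 1) :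
    ∫ x : ℝ × ℝ, ((1 + sq2 x)⁻¹) ^ 2 *
      (fun u : ℝ => -(u⁻¹) ^ 2 + (l + m) * u⁻¹ - 1 - 2 * Real.log u)
        ((l * sq2 x + m) / (1 + sq2 x)) = 0 := by
  by_cases hne : l = m
  · have h1 : l = 1 := by subst hne; nlinarith
    subst hne; subst h1
    have : ∀ x, (1 * sq2 x + 1) / (1 + sq2 x) = 1 := by
      intro x
      have := sq2_nonneg x
      rw [one_mul, add_comm, div_self (by positivity)]
    simp only [this]; norm_num
  rw [radial (fun t => ((1 + t)⁻¹) ^ 2 *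
      (fun u : ℝ => -(u⁻¹) ^ 2 + (l + m) * u⁻¹ - 1 - 2 * Real.log u)
        ((l * t + m) / (1 + t)))]
  set Φ := (fun u : ℝ => -(u⁻¹) ^ 2 + (l + m) * u⁻¹ - 1 - 2 * Real.log u) with hΦ
  set P := (fun u : ℝ => u⁻¹ + u + (l + m - 2 * u) * Real.log u) with hP
  have hne' : l - m ≠ 0 := sub_ne_zero.2 hne
  have hu : ∀ r : ℝ, (l * r ^ 2 + m) / (1 + r ^ 2) = l + (m - l) * (1 + r ^ 2)⁻¹ := by
    intro r
    have : (1 + r ^ 2) ≠ 0 := by positivity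
    field_simp; ring
  have hpos : ∀ r : ℝ, 0 < l + (m - l) * (1 + r ^ 2)⁻¹ := by
    intro r; rw [← hu]; positivity
  have hmem : ∀ r : ℝ, l + (m - l) * (1 + r ^ 2)⁻¹ ∈ Set.Icc (min l m) (max l m) := by
    intro r
    have h1 : 0 < (1 + r ^ 2)⁻¹ := by positivity
    have h2 : (1 + r ^ 2)⁻¹ ≤ 1 := inv_le_one_of_one_le₀ (by nlinarith [sq_nonneg r])
    rcases le_total l m with h | h
    · rw [min_eq_left h, max_eq_right h]; constructor <;> nlinarith
    · rw [min_eq_right h, max_eq_left h]; constructor <;> nlinarith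
  have hdP : ∀ u : ℝ, 0 < u → HasDerivAt P (Φ u) u := by
    intro u hu0
    have := ((hasDerivAt_inv hu0.ne').add (hasDerivAt_id u)).add
      ((((hasDerivAt_id u).const_mul 2).const_sub (l + m)).mul (Real.hasDerivAt_log hu0.ne'))
    refine this.congr_deriv ?_
    simp only [hΦ, id]
    field_simp
    ring
  have hcΦ : ContinuousOn Φ (Set.Icc (min l m) (max l m)) := by
    have hp : ∀ u ∈ Set.Icc (min l m) (max l m), u ≠ 0 := fun u hu =>
      (lt_of_lt_of_le (lt_min hl hm) hu.1).ne'
    have h1 : ContinuousOn (fun u : ℝ => u⁻¹) (Set.Icc (min l m) (max l m)) :=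
      continuousOn_id.inv₀ hp
    have h2 : ContinuousOn (fun u : ℝ => Real.log u) (Set.Icc (min l m) (max l m)) :=
      continuousOn_id.log hp
    exact (((h1.pow 2).neg.add (continuousOn_const.mul h1)).sub continuousOn_const).sub
      (continuousOn_const.mul h2)
  obtain ⟨C, hC⟩ := isCompact_Icc.exists_bound_of_continuousOn hcΦ
  have h := integral_Ioi_of_hasDerivAt_of_tendsto' (a := (0:ℝ)) (m := P l / (2 * (l - m)))
    (f := fun r : ℝ => P (l + (m - l) * (1 + r ^ 2)⁻¹) / (2 * (l - m)))
    (f' := fun r : ℝ => r * (((1 + r ^ 2)⁻¹) ^ 2 * Φ (l + (m - l) * (1 + r ^ 2)⁻¹)))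
    (fun r _ => by
      have h1 := ((hd_inv r).const_mul (m - l)).const_add l
      have h2 := ((hdP _ (hpos r)).comp r h1).div_const (2 * (l - m))
      refine h2.congr_deriv ?_
      field_simp
      ring)
    (by
      apply aux_int1 _ _ C
      · intro r _; exact hC _ (hmem r)
      · apply hcΦ.comp _ (fun r _ => hmem r)
        apply Continuous.continuousOn
        exact continuous_const.add (continuous_const.mul
          cont1))
    (by
      have h1 : Filter.Tendsto (fun r : ℝ => l + (m - l) * (1 + r ^ 2)⁻¹) Filter.atTop
          (nhds l) := by simpa using (tend_inv.const_mul (m - l)).const_add l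
      exact (((hdP l hl).continuousAt.tendsto.comp h1)).div_const _)
  simp only [hu]
  rw [h]
  have e : P l = P m := by
    have : m = l⁻¹ := by field_simp; linarith
    simp only [hP]
    rw [this, Real.log_inv, inv_inv]; ring
  simp [e]

lemma cv (α : ℂ) (G : ℂ → ℝ) :
    ∫ z : ℂ, ((1 + Complex.normSq z)⁻¹) ^ 2 * G z =
      ∫ z : ℂ, ((1 + Complex.normSq z)⁻¹) ^ 2 *
        G ((α * z - 1) / (z + (starRingEnd ℂ) α)) := by
  set β := (starRingEnd ℂ) α with hβ
  have hN : α * β + 1 ≠ 0 := by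
    rw [hβ, Complex.mul_conj]
    have := Complex.normSq_nonneg α
    intro h
    have h2 : ((Complex.normSq α + 1 : ℝ) : ℂ) = 0 := by push_cast; exact h
    rw [Complex.ofReal_eq_zero] at h2
    linarith
  have hs : ∀ z ∈ ({-β}ᶜ : Set ℂ), z + β ≠ 0 := by
    intro z hz h
    exact hz (eq_neg_of_add_eq_zero_left h)
  have himg : Set.image (fun z : ℂ => (α * z - 1) / (z + β)) ({-β}ᶜ : Set ℂ) = {α}ᶜ := by
    ext w
    constructor
    · rintro ⟨z, hz, rfl⟩ h
      have hz' := hs z hz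
      have h : (α * z - 1) / (z + β) = α := h
      rw [div_eq_iff hz'] at h
      apply hN
      linear_combination -h
    · intro hw
      have hw' : α - w ≠ 0 := fun h => hw (sub_eq_zero.1 h).symm
      have e : (1 + β * w) / (α - w) + β = (α * β + 1) / (α - w) := by
        field_simp; ring
      refine ⟨(1 + β * w) / (α - w), ?_, ?_⟩
      · intro h
        have h : (1 + β * w) / (α - w) = -β := h
        rw [h, neg_add_cancel] at e
        exact div_ne_zero hN hw' e.symm
      · simp only [e]
        field_simp
        ring
  have hinj : Set.InjOn (fun z : ℂ => (α * z - 1) / (z + β)) ({-β}ᶜ : Set ℂ) := by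
    intro z hz w hw h
    have hz' := hs z hz
    have hw' := hs w hw
    simp only [] at h
    rw [div_eq_div_iff hz' hw'] at h
    have : (α * β + 1) * (z - w) = 0 := by linear_combination h
    rcases mul_eq_zero.1 this with h | h
    · exact absurd h hN
    · exact sub_eq_zero.1 h
  have hder : ∀ z ∈ ({-β}ᶜ : Set ℂ), HasFDerivWithinAt (fun z : ℂ => (α * z - 1) / (z + β))
      (((ContinuousLinearMap.toSpanSingleton ℂ ((α * β + 1) / (z + β) ^ 2) : ℂ →L[ℂ] ℂ)).restrictScalars ℝ)
      ({-β}ᶜ : Set ℂ) z := by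
    intro z hz
    have hz' := hs z hz
    have h1 : HasDerivAt (fun z : ℂ => (α * z - 1) / (z + β)) ((α * β + 1) / (z + β) ^ 2) z := by
      have := (((hasDerivAt_id z).const_mul α).sub_const 1).div ((hasDerivAt_id z).add_const β) hz'
      refine this.congr_deriv ?_
      simp only [id]
      congr 1
      ring
    exact (h1.hasFDerivAt.restrictScalars ℝ).hasFDerivWithinAt
  have hdet : ∀ c : ℂ, ((ContinuousLinearMap.toSpanSingleton ℂ c : ℂ →L[ℂ] ℂ).restrictScalars ℝ).det
      = Complex.normSq c := by
    intro c
    have h1 : LinearMap.det (ContinuousLinearMap.toSpanSingleton ℂ c : ℂ →L[ℂ] ℂ).toLinearMap = c := by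
      simp
    have := LinearMap.det_restrictScalars (R := ℝ) (S := ℂ) (A := ℂ)
      (f := (ContinuousLinearMap.toSpanSingleton ℂ c : ℂ →L[ℂ] ℂ).toLinearMap)
    rw [h1, Algebra.norm_complex_apply] at this
    exact this
  have key := integral_image_eq_integral_abs_det_fderiv_smul (volume : Measure ℂ)
    (measurableSet_singleton (-β)).compl hder hinj
    (fun z => ((1 + Complex.normSq z)⁻¹) ^ 2 * G z)
  rw [himg, restrict_compl_singleton] at key
  rw [key]
  conv_rhs => rw [← restrict_compl_singleton (μ := (volume : Measure ℂ)) (-β)]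
  apply setIntegral_congr_fun (measurableSet_singleton (-β)).compl
  intro z hz
  have hz' := hs z hz
  have hz0 : Complex.normSq (z + β) ≠ 0 := (Complex.normSq_pos.2 hz').ne'
  simp only [hdet, smul_eq_mul]
  rw [abs_of_nonneg (Complex.normSq_nonneg _), ← mul_assoc]
  congr 1
  rw [Complex.normSq_div, Complex.normSq_div, map_pow]
  have e1 : Complex.normSq (α * z - 1) + Complex.normSq (z + β)
      = (1 + Complex.normSq z) * (Complex.normSq α + 1) := by
    simp only [hβ, Complex.normSq_apply, Complex.add_re, Complex.add_im, Complex.sub_re,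
      Complex.sub_im, Complex.mul_re, Complex.mul_im, Complex.conj_re, Complex.conj_im,
      Complex.one_re, Complex.one_im]
    ring
  have e2 : Complex.normSq (α * β + 1) = (Complex.normSq α + 1) ^ 2 := by
    rw [hβ, Complex.mul_conj, ← Complex.ofReal_one, ← Complex.ofReal_add, Complex.normSq_ofReal]
    ring
  have e3 : 1 + Complex.normSq (α * z - 1) / Complex.normSq (z + β) =
      (1 + Complex.normSq z) * (Complex.normSq α + 1) / Complex.normSq (z + β) := by
    rw [← e1]; field_simp; ring
  rw [e3, e2]
  have hp1 : Complex.normSq α + 1 ≠ 0 := by have := Complex.normSq_nonneg α; positivity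
  have hp2 : 1 + Complex.normSq z ≠ 0 := by have := Complex.normSq_nonneg z; positivity
  field_simp

/-- the quadratic form -/
def Qf (p q1 q2 r : ℝ) (x : ℝ × ℝ) : ℝ := p * sq2 x + 2 * (q1 * x.1 + q2 * x.2) + r

lemma toC (f : ℂ → ℝ) : ∫ x : ℝ × ℝ, f (cx x) = ∫ z : ℂ, f z :=
  Complex.volume_preserving_equiv_real_prod.symm.integral_comp' f

lemma nsq_cx (x : ℝ × ℝ) : Complex.normSq (cx x) = sq2 x := by
  simp [cx, sq2, Complex.normSq_apply]; ring

lemma diag (p q1 q2 r : ℝ) (hp : 0 < p) (hr : 0 < r) (hd : p * r - q1 ^ 2 - q2 ^ 2 = 1) :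
    ∃ l m : ℝ, 0 < l ∧ 0 < m ∧ l * m = 1 ∧ l + m = p + r ∧ ∀ F : ℝ → ℝ,
      ∫ x : ℝ × ℝ, ((1 + sq2 x)⁻¹) ^ 2 * F (Qf p q1 q2 r x / (1 + sq2 x)) =
      ∫ x : ℝ × ℝ, ((1 + sq2 x)⁻¹) ^ 2 * F ((l * sq2 x + m) / (1 + sq2 x)) := by
  by_cases hq : q1 ^ 2 + q2 ^ 2 = 0
  · have h1 : q1 = 0 := by nlinarith [sq_nonneg q1, sq_nonneg q2]
    have h2 : q2 = 0 := by nlinarith [sq_nonneg q1, sq_nonneg q2]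
    subst h1 h2
    refine ⟨p, r, hp, hr, by linarith, rfl, fun F => ?_⟩
    simp [Qf]
  set K := q1 ^ 2 + q2 ^ 2 with hK
  have hKpos : 0 < K := lt_of_le_of_ne (by positivity) (Ne.symm hq)
  obtain ⟨t, ht⟩ : ∃ t : ℝ, t ^ 2 * K + (r - p) * t - 1 = 0 := by
    refine ⟨(p - r + √((r - p) ^ 2 + 4 * K)) / (2 * K), ?_⟩
    have := Real.sq_sqrt (show 0 ≤ (r - p) ^ 2 + 4 * K by positivity)
    field_simp
    linear_combination this
  have hlm : (r + t * K) * (p - t * K) = 1 := by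
    linear_combination hd - K * ht
  have hsum : (r + t * K) + (p - t * K) = p + r := by ring
  have hl : 0 < r + t * K := by
    by_contra h
    have h := not_lt.1 h
    nlinarith
  have hm : 0 < p - t * K := by
    by_contra h
    have h := not_lt.1 h
    nlinarith
  refine ⟨r + t * K, p - t * K, hl, hm, hlm, hsum, fun F => ?_⟩
  have c1 := toC (fun z => ((1 + Complex.normSq z)⁻¹) ^ 2 *
    F ((p * Complex.normSq z + 2 * (q1 * z.re + q2 * z.im) + r) / (1 + Complex.normSq z)))
  have c2 := toC (fun z => ((1 + Complex.normSq z)⁻¹) ^ 2 *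
    F (((r + t * K) * Complex.normSq z + (p - t * K)) / (1 + Complex.normSq z)))
  simp only [nsq_cx] at c1 c2
  simp only [cx] at c1
  unfold Qf
  rw [c1, c2]
  rw [cv ⟨t * q1, t * q2⟩ (fun z => F ((p * Complex.normSq z + 2 * (q1 * z.re + q2 * z.im) + r) / (1 + Complex.normSq z)))]
  rw [← restrict_compl_singleton (μ := (volume : Measure ℂ)) (-(starRingEnd ℂ) ⟨t * q1, t * q2⟩)]
  apply setIntegral_congr_fun (measurableSet_singleton _).compl
  intro z hz
  have hz' : z + (starRingEnd ℂ) ⟨t * q1, t * q2⟩ ≠ 0 := by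
    intro h
    exact hz (eq_neg_of_add_eq_zero_left h)
  have hz0 : Complex.normSq (z + (starRingEnd ℂ) ⟨t * q1, t * q2⟩) ≠ 0 :=
    (Complex.normSq_pos.2 hz').ne'
  simp only []
  congr 2
  have hzz := Complex.normSq_nonneg z
  rw [Complex.normSq_div, Complex.div_re, Complex.div_im]
  obtain ⟨a, b⟩ := z
  simp only [Complex.normSq_apply, Complex.add_re, Complex.add_im, Complex.sub_re,
      Complex.sub_im, Complex.mul_re, Complex.mul_im, Complex.conj_re, Complex.conj_im,
      Complex.one_re, Complex.one_im] at hz0 hzz ⊢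
  set D := (a + t * q1) * (a + t * q1) + (b + -(t * q2)) * (b + -(t * q2)) with hD
  have hN : 1 + t ^ 2 * K ≠ 0 := by positivity
  have hz1 : 1 + (a * a + b * b) ≠ 0 := by positivity
  have e2 : 1 + ((t * q1 * a - t * q2 * b - 1) * (t * q1 * a - t * q2 * b - 1) +
      (t * q1 * b + t * q2 * a - 0) * (t * q1 * b + t * q2 * a - 0)) / D
      = (1 + (a * a + b * b)) * (1 + t ^ 2 * K) / D := by
    rw [eq_div_iff hz0, add_mul, div_mul_cancel₀ _ hz0, hD, hK]
    ring
  rw [e2]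
  rw [div_eq_div_iff (div_ne_zero (mul_ne_zero hz1 hN) hz0) hz1]
  have e1 : ∀ A B1 B2 B3 B4 : ℝ, A + 2 * (q1 * (B1 + B2) + q2 * (B3 - B4)) + r * D
      = ((r + t * K) * (a * a + b * b) + (p - t * K)) * (1 + t ^ 2 * K) →
      p * (A / p / D) + 2 * (q1 * (B1 / D + B2 / D) + q2 * (B3 / D - B4 / D)) + r
      = ((r + t * K) * (a * a + b * b) + (p - t * K)) * (1 + t ^ 2 * K) / D := by
    intro A B1 B2 B3 B4 h
    rw [← h]
    field_simp
  have e3 := e1 (p * ((t * q1 * a - t * q2 * b - 1) * (t * q1 * a - t * q2 * b - 1) +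
      (t * q1 * b + t * q2 * a - 0) * (t * q1 * b + t * q2 * a - 0)))
      ((t * q1 * a - t * q2 * b - 1) * (a + t * q1))
      ((t * q1 * b + t * q2 * a - 0) * (b + -(t * q2)))
      ((t * q1 * b + t * q2 * a - 0) * (a + t * q1))
      ((t * q1 * a - t * q2 * b - 1) * (b + -(t * q2))) (by
        rw [hK] at ht
        rw [hD, hK]
        linear_combination (-t * (q1 ^ 2 + q2 ^ 2) * (a * a + b * b) + t * (q1 ^ 2 + q2 ^ 2)
          + 2 * (a * q1 - b * q2)) * ht)
  rw [mul_div_cancel_left₀ _ hp.ne'] at e3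
  rw [e3]
  ring

lemma odd_zero (f : ℝ × ℝ → ℝ) (hf : ∀ x, f (-x) = -f x) : ∫ x, f x = 0 := by
  have h := integral_neg_eq_self f (volume : Measure (ℝ × ℝ))
  simp only [hf, integral_neg] at h
  linarith

lemma frac_bd (x : ℝ × ℝ) (n : ℝ) (h : |n| ≤ 1 + sq2 x) : |n * (1 + sq2 x)⁻¹| ≤ 1 := by
  have := sq2_nonneg x
  rw [abs_mul, abs_of_pos (show 0 < (1 + sq2 x)⁻¹ by positivity), ← div_eq_mul_inv,
    div_le_one (by positivity)]
  exact h

lemma base_mom (a b1 b2 c : ℝ) :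
    Integrable (fun x : ℝ × ℝ => (a + b1 * x.1 + b2 * x.2 + c * sq2 x) * ((1 + sq2 x)⁻¹) ^ 3) ∧
    ∫ x : ℝ × ℝ, (a + b1 * x.1 + b2 * x.2 + c * sq2 x) * ((1 + sq2 x)⁻¹) ^ 3
      = Real.pi / 2 * (a + c) := by
  have hc := mu1_cont
  have i0 := bdd_int (f := fun x => 1 * (1 + sq2 x)⁻¹) (by fun_prop) 1
    (fun x => frac_bd x _ (by have := sq2_nonneg x; simp; linarith))
  have i1 := bdd_int (f := fun x => x.1 * (1 + sq2 x)⁻¹) (by fun_prop) 1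
    (fun x => frac_bd x _ (by
      unfold sq2; rw [abs_le]; constructor <;> nlinarith [sq_nonneg (x.1 - 1), sq_nonneg (x.1 + 1), sq_nonneg x.2]))
  have i2 := bdd_int (f := fun x => x.2 * (1 + sq2 x)⁻¹) (by fun_prop) 1
    (fun x => frac_bd x _ (by
      unfold sq2; rw [abs_le]; constructor <;> nlinarith [sq_nonneg (x.2 - 1), sq_nonneg (x.2 + 1), sq_nonneg x.1]))
  have e : ∀ x : ℝ × ℝ, (a + b1 * x.1 + b2 * x.2 + c * sq2 x) * ((1 + sq2 x)⁻¹) ^ 3 =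
      (a - c) * (((1 + sq2 x)⁻¹) ^ 2 * (1 * (1 + sq2 x)⁻¹)) +
      b1 * (((1 + sq2 x)⁻¹) ^ 2 * (x.1 * (1 + sq2 x)⁻¹)) +
      b2 * (((1 + sq2 x)⁻¹) ^ 2 * (x.2 * (1 + sq2 x)⁻¹)) + c * ((1 + sq2 x)⁻¹) ^ 2 := by
    intro x
    have := sq2_nonneg x
    have : 1 + sq2 x ≠ 0 := by positivity
    field_simp
    ring
  simp only [e]
  have j0 := i0.const_mul (a - c)
  have j1 := i1.const_mul b1
  have j2 := i2.const_mul b2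
  have j3 := mu_int.const_mul c
  refine ⟨((j0.add j1).add j2).add j3, ?_⟩
  rw [integral_add (by exact (j0.add j1).add j2) j3, integral_add (by exact j0.add j1) j2,
    integral_add j0 j1]
  simp only [integral_const_mul]
  have v0 : ∫ x : ℝ × ℝ, ((1 + sq2 x)⁻¹) ^ 2 * (1 * (1 + sq2 x)⁻¹) = Real.pi / 2 := by
    rw [← mu3_val]; congr 1; ext x; ring
  have hneg : ∀ x : ℝ × ℝ, sq2 (-x) = sq2 x := by intro x; simp [sq2]
  have v1 : ∫ x : ℝ × ℝ, ((1 + sq2 x)⁻¹) ^ 2 * (x.1 * (1 + sq2 x)⁻¹) = 0 :=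
    odd_zero _ (fun x => by simp [hneg])
  have v2 : ∫ x : ℝ × ℝ, ((1 + sq2 x)⁻¹) ^ 2 * (x.2 * (1 + sq2 x)⁻¹) = 0 :=
    odd_zero _ (fun x => by simp [hneg])
  rw [v0, v1, v2, mu_val]
  ring

lemma mom (p q1 q2 r : ℝ) (hp : 0 < p) (hd : p * r - q1 ^ 2 - q2 ^ 2 = 1) (a b1 b2 c : ℝ) :
    Integrable (fun x : ℝ × ℝ => (a + b1 * x.1 + b2 * x.2 + c * sq2 x) / (Qf p q1 q2 r x) ^ 3) ∧
    ∫ x : ℝ × ℝ, (a + b1 * x.1 + b2 * x.2 + c * sq2 x) / (Qf p q1 q2 r x) ^ 3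
      = Real.pi / 2 * (a * p + c * r - b1 * q1 - b2 * q2) := by
  obtain ⟨hi, hv⟩ := base_mom (p ^ 3 * a - p ^ 2 * (b1 * q1 + b2 * q2) + p * c * (q1 ^ 2 + q2 ^ 2))
    (p ^ 2 * b1 - 2 * p * c * q1) (p ^ 2 * b2 - 2 * p * c * q2) (p * c)
  set g := (fun x : ℝ × ℝ => (p ^ 3 * a - p ^ 2 * (b1 * q1 + b2 * q2) + p * c * (q1 ^ 2 + q2 ^ 2) +
    (p ^ 2 * b1 - 2 * p * c * q1) * x.1 + (p ^ 2 * b2 - 2 * p * c * q2) * x.2 + p * c * sq2 x) *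
      ((1 + sq2 x)⁻¹) ^ 3) with hg
  have e : (fun x : ℝ × ℝ => (a + b1 * x.1 + b2 * x.2 + c * sq2 x) / (Qf p q1 q2 r x) ^ 3) =
      fun x => (fun y => g (y + (q1, q2))) (p • x) := by
    ext x
    have h1 : 1 + sq2 (p • x + (q1, q2)) = p * Qf p q1 q2 r x := by
      simp only [sq2, Qf, Prod.fst_add, Prod.snd_add, Prod.smul_fst, Prod.smul_snd, smul_eq_mul]
      linear_combination -hd
    have h0 : Qf p q1 q2 r x ≠ 0 := by
      intro h
      rw [h] at h1
      have := sq2_nonneg (p • x + (q1, q2))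
      linarith
    simp only [hg]
    rw [h1]
    have h2 : p ^ 3 * a - p ^ 2 * (b1 * q1 + b2 * q2) + p * c * (q1 ^ 2 + q2 ^ 2) +
    (p ^ 2 * b1 - 2 * p * c * q1) * (p • x + (q1, q2)).1 + (p ^ 2 * b2 - 2 * p * c * q2) * (p • x + (q1, q2)).2 + p * c * sq2 (p • x + (q1, q2)) = p ^ 3 * (a + b1 * x.1 + b2 * x.2 + c * sq2 x) := by
      simp only [sq2, Prod.fst_add, Prod.snd_add, Prod.smul_fst, Prod.smul_snd, smul_eq_mul]
      ring
    rw [h2]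
    field_simp
  rw [e]
  constructor
  · exact (hi.comp_add_right (q1, q2)).comp_smul hp.ne'
  · rw [Measure.integral_comp_smul volume (fun y => g (y + (q1, q2))) p, integral_add_right_eq_self g, hv]
    have : Module.finrank ℝ (ℝ × ℝ) = 2 := by simp
    rw [this, abs_of_pos (by positivity), smul_eq_mul]
    field_simp
    linear_combination (-c) * hd

lemma Qf_lower (p q1 q2 r : ℝ) (hp : 0 < p) (hr : 0 < r) (hd : p * r - q1 ^ 2 - q2 ^ 2 = 1)
    (x : ℝ × ℝ) : (p + r)⁻¹ ≤ Qf p q1 q2 r x / (1 + sq2 x) := by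
  have := sq2_nonneg x
  rw [le_div_iff₀ (by positivity), inv_mul_le_iff₀ (by positivity)]
  have h : (p + r) * Qf p q1 q2 r x - (1 + sq2 x) = (p * x.1 + q1) ^ 2 + (p * x.2 + q2) ^ 2
      + (q1 * x.1 + q2 * x.2 + r) ^ 2 + (q1 * x.2 - q2 * x.1) ^ 2 := by
    simp only [Qf, sq2]
    linear_combination (1 + x.1 ^ 2 + x.2 ^ 2) * hd
  nlinarith [sq_nonneg (p * x.1 + q1), sq_nonneg (p * x.2 + q2),
    sq_nonneg (q1 * x.1 + q2 * x.2 + r), sq_nonneg (q1 * x.2 - q2 * x.1)]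

lemma Qf_upper (p q1 q2 r : ℝ) (hp : 0 < p) (hr : 0 < r) (hd : p * r - q1 ^ 2 - q2 ^ 2 = 1)
    (x : ℝ × ℝ) : Qf p q1 q2 r x / (1 + sq2 x) ≤ p + r := by
  have := sq2_nonneg x
  rw [div_le_iff₀ (by positivity)]
  have h : r * ((p + r) * (1 + sq2 x) - Qf p q1 q2 r x)
      = (r * x.1 - q1) ^ 2 + (r * x.2 - q2) ^ 2 + 1 := by
    simp only [Qf, sq2]
    linear_combination hd
  have : 0 < (p + r) * (1 + sq2 x) - Qf p q1 q2 r x := by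
    by_contra h2
    have h2 := not_lt.1 h2
    nlinarith [sq_nonneg (r * x.1 - q1), sq_nonneg (r * x.2 - q2)]
  linarith

lemma Qf_pos (p q1 q2 r : ℝ) (hp : 0 < p) (hr : 0 < r) (hd : p * r - q1 ^ 2 - q2 ^ 2 = 1)
    (x : ℝ × ℝ) : 0 < Qf p q1 q2 r x := by
  have h := Qf_lower p q1 q2 r hp hr hd x
  have h1 := sq2_nonneg x
  have : 0 < Qf p q1 q2 r x / (1 + sq2 x) := lt_of_lt_of_le (by positivity) h
  exact (div_pos_iff_of_pos_right (by positivity)).1 this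

lemma Qf_int (p q1 q2 r : ℝ) (hp : 0 < p) (hr : 0 < r) (hd : p * r - q1 ^ 2 - q2 ^ 2 = 1)
    (F : ℝ → ℝ) (hF : ContinuousOn F (Set.Icc (p + r)⁻¹ (p + r))) :
    Integrable (fun x : ℝ × ℝ => ((1 + sq2 x)⁻¹) ^ 2 * F (Qf p q1 q2 r x / (1 + sq2 x))) := by
  obtain ⟨C, hC⟩ := isCompact_Icc.exists_bound_of_continuousOn hF
  have hm : ∀ x, Qf p q1 q2 r x / (1 + sq2 x) ∈ Set.Icc (p + r)⁻¹ (p + r) := fun x =>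
    ⟨Qf_lower p q1 q2 r hp hr hd x, Qf_upper p q1 q2 r hp hr hd x⟩
  refine bdd_int (f := fun x => F (Qf p q1 q2 r x / (1 + sq2 x))) ?_ C (fun x => hC _ (hm x))
  refine hF.comp_continuous ?_ hm
  have h1 := mu1_cont
  have h2 := sq2_cont
  simp only [div_eq_mul_inv]
  unfold Qf
  fun_prop

lemma Qf_key (p q1 q2 r : ℝ) (hp : 0 < p) (hr : 0 < r) (hd : p * r - q1 ^ 2 - q2 ^ 2 = 1) :
    ∫ x : ℝ × ℝ, ((1 + sq2 x)⁻¹) ^ 2 *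
      (fun u : ℝ => -(u⁻¹) ^ 2 + (p + r) * u⁻¹ - 1) (Qf p q1 q2 r x / (1 + sq2 x))
    = 2 * ∫ x : ℝ × ℝ, ((1 + sq2 x)⁻¹) ^ 2 * Real.log (Qf p q1 q2 r x / (1 + sq2 x)) := by
  obtain ⟨l, m, hl, hm, hlm, hs, h⟩ := diag p q1 q2 r hp hr hd
  have h0 := int_Phi l m hl hm hlm
  rw [hs] at h0
  rw [← h (fun u => -(u⁻¹) ^ 2 + (p + r) * u⁻¹ - 1 - 2 * Real.log u)] at h0
  have hp' : ∀ u ∈ Set.Icc (p + r)⁻¹ (p + r), u ≠ 0 := fun u hu =>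
    (lt_of_lt_of_le (by positivity) hu.1).ne'
  have h1 : ContinuousOn (fun u : ℝ => u⁻¹) (Set.Icc (p + r)⁻¹ (p + r)) :=
    continuousOn_id.inv₀ hp'
  have i1 := Qf_int p q1 q2 r hp hr hd (fun u : ℝ => -(u⁻¹) ^ 2 + (p + r) * u⁻¹ - 1)
    (((h1.pow 2).neg.add (continuousOn_const.mul h1)).sub continuousOn_const)
  have i2 := Qf_int p q1 q2 r hp hr hd (fun u : ℝ => Real.log u) (continuousOn_id.log hp')
  have h2 := integral_sub i1 (i2.const_mul 2)
  rw [integral_const_mul] at h2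
  rw [← sub_eq_zero, ← h2, ← h0]
  congr 1
  ext x
  ring

lemma SPinv_two (x : ℝ × ℝ) : SPinv x 2 ≠ 1 := by
  have := sq2_nonneg x
  have h : (1 + sq2 x) ≠ 0 := by positivity
  simp only [SPinv]
  intro h1
  have h1 : (sq2 x - 1) / (1 + sq2 x) = 1 := h1
  rw [div_eq_one_iff_eq h] at h1
  linarith

lemma SP_SPinv (x : ℝ × ℝ) : SP (SPinv x) = x := by
  have := sq2_nonneg x
  have h : (1 + sq2 x) ≠ 0 := by positivity
  have e0 : SPinv x 0 = 2 * x.1 / (1 + sq2 x) := rfl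
  have e1 : SPinv x 1 = 2 * x.2 / (1 + sq2 x) := rfl
  have e2 : 1 - SPinv x 2 = 2 / (1 + sq2 x) := by
    have : SPinv x 2 = (sq2 x - 1) / (1 + sq2 x) := rfl
    rw [this]; field_simp; ring
  unfold SP
  rw [e0, e1, e2]
  ext
  · simp only []; field_simp
  · simp only []; field_simp

lemma jac_form (A : SL2C) : ∃ p q1 q2 r : ℝ, 0 < p ∧ 0 < r ∧ p * r - q1 ^ 2 - q2 ^ 2 = 1 ∧
    ∀ x, jacA A (SPinv x) = ((1 + sq2 x) / Qf p q1 q2 r x) ^ 2 := by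
  have hdet := A.2
  rw [Matrix.det_fin_two] at hdet
  set a := A.1 0 0
  set b := A.1 0 1
  set c := A.1 1 0
  set d := A.1 1 1
  have hre := congrArg Complex.re hdet
  have him := congrArg Complex.im hdet
  simp only [Complex.sub_re, Complex.sub_im, Complex.mul_re, Complex.mul_im, Complex.one_re,
    Complex.one_im] at hre him
  have hd : (Complex.normSq a + Complex.normSq c) * (Complex.normSq b + Complex.normSq d)
      - (a.re * b.re + a.im * b.im + c.re * d.re + c.im * d.im) ^ 2
      - (a.re * b.im - a.im * b.re + c.re * d.im - c.im * d.re) ^ 2 = 1 := by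
    simp only [Complex.normSq_apply]
    linear_combination (a.re * d.re - a.im * d.im - (b.re * c.re - b.im * c.im) + 1) * hre +
      (a.re * d.im + a.im * d.re - (b.re * c.im + b.im * c.re)) * him
  have ha := Complex.normSq_nonneg a
  have hb := Complex.normSq_nonneg b
  have hc := Complex.normSq_nonneg c
  have hd' := Complex.normSq_nonneg d
  have hpr : 0 < (Complex.normSq a + Complex.normSq c) * (Complex.normSq b + Complex.normSq d) := by
    nlinarith [sq_nonneg (a.re * b.re + a.im * b.im + c.re * d.re + c.im * d.im),
      sq_nonneg (a.re * b.im - a.im * b.re + c.re * d.im - c.im * d.re)]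
  refine ⟨_, _, _, _, pos_of_mul_pos_left hpr (by positivity),
    pos_of_mul_pos_right hpr (by positivity), hd, fun x => ?_⟩
  unfold jacA
  rw [if_neg (SPinv_two x), SP_SPinv, nsq_cx]
  congr 2
  simp only [Qf, sq2, cx, Complex.normSq_apply, Complex.add_re, Complex.add_im, Complex.mul_re,
    Complex.mul_im]
  ring

lemma grad_form (p q1 q2 r k : ℝ) (hp : 0 < p) (hr : 0 < r) (hd : p * r - q1 ^ 2 - q2 ^ 2 = 1)
    (x : ℝ × ℝ) :
    gradSq (fun y => (3 / 4) * Real.log (((1 + sq2 y) / Qf p q1 q2 r y) ^ 2) + k) x =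
    9 * (((1 + sq2 x)⁻¹) ^ 2 *
      (fun u : ℝ => -(u⁻¹) ^ 2 + (p + r) * u⁻¹ - 1) (Qf p q1 q2 r x / (1 + sq2 x))) := by
  have hQ := Qf_pos p q1 q2 r hp hr hd
  have hS : ∀ y : ℝ × ℝ, 0 < 1 + sq2 y := fun y => by have := sq2_nonneg y; positivity
  have e : (fun y => (3 / 4) * Real.log (((1 + sq2 y) / Qf p q1 q2 r y) ^ 2) + k) =
      fun y => (3 / 2) * (Real.log (1 + sq2 y) - Real.log (Qf p q1 q2 r y)) + k := by
    ext y
    rw [Real.log_pow, Real.log_div (hS y).ne' (hQ y).ne']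
    push_cast; ring
  rw [e]
  have d1 : HasFDerivAt (fun y : ℝ × ℝ => y.1) (ContinuousLinearMap.fst ℝ ℝ ℝ) x := hasFDerivAt_fst
  have d2 : HasFDerivAt (fun y : ℝ × ℝ => y.2) (ContinuousLinearMap.snd ℝ ℝ ℝ) x := hasFDerivAt_snd
  have ds : HasFDerivAt sq2 ((2 * x.1) • ContinuousLinearMap.fst ℝ ℝ ℝ +
      (2 * x.2) • ContinuousLinearMap.snd ℝ ℝ ℝ) x := by
    have := (d1.pow 2).add (d2.pow 2)
    unfold sq2
    refine this.congr_fderiv ?_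
    ext <;> simp
  have dQ : HasFDerivAt (Qf p q1 q2 r) ((2 * (p * x.1 + q1)) • ContinuousLinearMap.fst ℝ ℝ ℝ +
      (2 * (p * x.2 + q2)) • ContinuousLinearMap.snd ℝ ℝ ℝ) x := by
    have := ((ds.const_mul p).add (((d1.const_mul q1).add (d2.const_mul q2)).const_mul 2)).add_const r
    unfold Qf
    refine this.congr_fderiv ?_
    ext <;> simp <;> ring
  have dd := ((((ds.const_add 1).log (hS x).ne').sub (dQ.log (hQ x).ne')).const_mul (3 / 2)).add_const k
  simp only [Pi.sub_apply] at dd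
  unfold gradSq
  rw [dd.fderiv]
  simp only [ContinuousLinearMap.smul_apply, ContinuousLinearMap.sub_apply,
    ContinuousLinearMap.add_apply, ContinuousLinearMap.coe_fst', ContinuousLinearMap.coe_snd',
    smul_eq_mul]
  have h1 := (hS x).ne'
  have h2 := (hQ x).ne'
  set S := 1 + sq2 x with hSd
  set Q := Qf p q1 q2 r x with hQd
  field_simp
  have hS' : S = 1 + x.1 ^ 2 + x.2 ^ 2 := by rw [hSd, sq2]; ring
  have hQ' : Q = p * (x.1 ^ 2 + x.2 ^ 2) + 2 * (q1 * x.1 + q2 * x.2) + r := by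
    rw [hQd, Qf, sq2]
  rw [hS', hQ']
  linear_combination (-9 * (1 + x.1 ^ 2 + x.2 ^ 2)^2) * hd

/-- every `ψ_τ` is an extremal: `I_{2/3}(ψ_τ) = 0`. -/
theorem extremal_value (A : SL2C) : CG (2 / 3) (psiA A) = 0 := by
  obtain ⟨p, q1, q2, r, hp, hr, hd, hJ⟩ := jac_form A
  have hQ := Qf_pos p q1 q2 r hp hr hd
  have hS : ∀ y : ℝ × ℝ, 0 < 1 + sq2 y := fun y => by have := sq2_nonneg y; positivity
  have hpi := Real.pi_pos
  have hM0 : 0 < (p + r) / 2 := by positivity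
  have hJp : ∀ x, 0 < jacA A (SPinv x) := fun x => by
    rw [hJ]; have := hQ x; have := hS x; positivity
  have hJ3 : ∀ x, jacA A (SPinv x) ^ (3 / 2 : ℝ) = ((1 + sq2 x) / Qf p q1 q2 r x) ^ 3 := by
    intro x
    have := hQ x
    have := hS x
    rw [hJ, ← Real.rpow_natCast _ 2, ← Real.rpow_mul (by positivity), ← Real.rpow_natCast _ 3]
    norm_num
  have hmass : massA A = (p + r) / 2 := by
    unfold massA sphInt
    simp only [hJ3, smul_eq_mul]
    have h := (mom p q1 q2 r hp hd 1 0 0 1).2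
    have e : ∀ x : ℝ × ℝ, ((1 + sq2 x)⁻¹) ^ 2 * ((1 + sq2 x) / Qf p q1 q2 r x) ^ 3 =
        (1 + 0 * x.1 + 0 * x.2 + 1 * sq2 x) / Qf p q1 q2 r x ^ 3 := by
      intro x
      have := (hQ x).ne'
      have := (hS x).ne'
      field_simp
      ring
    simp only [e]
    rw [h]
    field_simp
    ring
  set M := (p + r) / 2 with hM
  have hexp : ∀ x, Real.exp (2 * psiA A (SPinv x)) = M⁻¹ * ((1 + sq2 x) / Qf p q1 q2 r x) ^ 3 := by
    intro x
    rw [← hJ3, psiA, cA, hmass, Real.rpow_def_of_pos (hJp x)]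
    rw [show 2 * (3 / 4 * Real.log (jacA A (SPinv x)) + -(1 / 2) * Real.log M)
      = -Real.log M + Real.log (jacA A (SPinv x)) * (3 / 2) by ring, Real.exp_add, Real.exp_neg,
      Real.exp_log hM0]
  have hE : (sphInt fun ω => Real.exp (2 * psiA A ω)) = 1 := by
    have h1 : massA A = M := hmass
    unfold massA sphInt at h1
    unfold sphInt
    simp only [hJ3, smul_eq_mul] at h1
    simp only [hexp, smul_eq_mul]
    simp only [mul_left_comm _ M⁻¹]
    rw [integral_const_mul, mul_left_comm, h1]
    field_simp
  have hV : ∀ i, (sphInt fun ω => Real.exp (2 * psiA A ω) • ω) i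
      = M⁻¹ * ![-q1, -q2, (r - p) / 2] i := by
    have e : ∀ (i : Fin 3) (x : ℝ × ℝ),
        (((1 + sq2 x)⁻¹) ^ 2 • Real.exp (2 * psiA A (SPinv x)) • SPinv x) i =
        M⁻¹ * ((![0, 0, -1] i + ![2, 0, 0] i * x.1 + ![0, 2, 0] i * x.2 + ![0, 0, 1] i * sq2 x)
          / Qf p q1 q2 r x ^ 3) := by
      intro i x
      have := (hQ x).ne'
      have := (hS x).ne'
      have := hM0.ne'
      rw [Pi.smul_apply, Pi.smul_apply, hexp]
      fin_cases i <;> simp [SPinv] <;> field_simp <;> ring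
    intro i
    unfold sphInt
    have hm := fun i : Fin 3 => mom p q1 q2 r hp hd (![0, 0, -1] i) (![2, 0, 0] i) (![0, 2, 0] i) (![0, 0, 1] i)
    rw [Pi.smul_apply, eval_integral]
    · simp only [e]
      rw [integral_const_mul, (hm i).2, smul_eq_mul]
      fin_cases i <;> simp <;> field_simp <;> ring
    · intro i
      simp only [e]
      exact (hm i).1.const_mul _
  have hG : gradTerm (psiA A) = (9 / (2 * Real.pi)) *
      ∫ x : ℝ × ℝ, ((1 + sq2 x)⁻¹) ^ 2 * Real.log (Qf p q1 q2 r x / (1 + sq2 x)) := by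
    unfold gradTerm psiA
    simp only [hJ]
    simp only [grad_form p q1 q2 r (cA A) hp hr hd]
    rw [integral_const_mul, Qf_key p q1 q2 r hp hr hd]
    field_simp
    ring
  have hp' : ∀ u ∈ Set.Icc (p + r)⁻¹ (p + r), u ≠ 0 := fun u hu =>
    (lt_of_lt_of_le (by positivity) hu.1).ne'
  have i2 := Qf_int p q1 q2 r hp hr hd (fun u : ℝ => Real.log u) (continuousOn_id.log hp')
  have hI : sphInt (psiA A) = -(3 / (2 * Real.pi)) *
      (∫ x : ℝ × ℝ, ((1 + sq2 x)⁻¹) ^ 2 * Real.log (Qf p q1 q2 r x / (1 + sq2 x)))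
        - (1 / 2) * Real.log M := by
    unfold sphInt psiA
    have e : ∀ x : ℝ × ℝ, ((1 + sq2 x)⁻¹) ^ 2 • (3 / 4 * Real.log (jacA A (SPinv x)) + cA A) =
        -(3 / 2) * (((1 + sq2 x)⁻¹) ^ 2 * Real.log (Qf p q1 q2 r x / (1 + sq2 x)))
          + cA A * ((1 + sq2 x)⁻¹) ^ 2 := by
      intro x
      rw [hJ, Real.log_pow, Real.log_div (hS x).ne' (hQ x).ne', Real.log_div (hQ x).ne' (hS x).ne',
        smul_eq_mul]
      push_cast
      ring
    simp only [e]
    rw [integral_add (i2.const_mul _) (mu_int.const_mul _), integral_const_mul, integral_const_mul,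
      mu_val, cA, hmass, smul_eq_mul]
    field_simp
    ring
  unfold CG
  rw [hE, hG, hI]
  unfold norm3sq dot3
  simp only [hV]
  have hlog : (1:ℝ) ^ 2 - (M⁻¹ * ![-q1, -q2, (r - p) / 2] 0 * (M⁻¹ * ![-q1, -q2, (r - p) / 2] 0) +
      M⁻¹ * ![-q1, -q2, (r - p) / 2] 1 * (M⁻¹ * ![-q1, -q2, (r - p) / 2] 1) +
      M⁻¹ * ![-q1, -q2, (r - p) / 2] 2 * (M⁻¹ * ![-q1, -q2, (r - p) / 2] 2)) = (M⁻¹) ^ 2 := by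
    have := hM0.ne'
    simp
    field_simp
    rw [hM]
    linear_combination 4 * hd
  rw [hlog, Real.log_pow, Real.log_inv]
  push_cast
  field_simp
  ring
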